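/- Let p in Z[x] be a monic polynomial of degree t whose distinct complex roots r_1, ..., r_n are all nonzero, say p = prod_{i=1}^n (x - r_i)^{m_i} with integer multiplicities m_i >= 1. Write c_j for the codegree-j coefficient of p (c_0 = 1), and set M = max(max_{i,j} |r_i - r_j|, 1), m = min(min_{i != j} |r_i - r_j|, 1), R = max(max_i |r_i|, 1), r = min(min_i |r_i|, 1), and c = max(max_{1 <= i <= n} |c_i|, 1). Let rtilde_1, ..., rtilde_n be complex numbers with |rtilde_i - r_i| <= epsilon for all i, where 0 < epsilon < (m^2 * r / (2^{2n+7} * n^5)) * (m/(M*R*c))^n. Then the rtilde_i are pairwise distinct and nonzero; the matrix Lambda * C * Vtilde_0 is invertible, where Vtilde_0 is the n-by-n matrix with (i,j) entry rtilde_j^i, C is the n-by-n lower-triangular Toeplitz matrix with (i,j) entry c_{i-j} for i >= j and 0 otherwise, and Lambda = -diag(1, 1/2, ..., 1/n); and the vector mtilde = (Lambda * C * Vtilde_0)^{-1} * (c_1, ..., c_n)^T satisfies |mtilde_i - m_i| < 1/2 for every i, so each multiplicity m_i is the unique integer within distance 1/2 of mtilde_i. (Theorem 2: the computation of the multiplicities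 from approximate roots is numerically stable.) -/

import Mathlib

open Polynomial Finset Matrix

theorem newton_identity_prod {σ : Type*} [Fintype σ] (f : σ → ℂ) (k : ℕ)
    (hk : k ≤ Fintype.card σ) :
    (k : ℂ) * (∏ x, (X - C (f x))).coeff (Fintype.card σ - k) =
      -∑ j ∈ range k, (∏ x, (X - C (f x))).coeff (Fintype.card σ - j) * ∑ x, f x ^ (k - j) := by
  classical
  have hcoeff : ∀ j ≤ Fintype.card σ, (∏ x, (X - C (f x))).coeff (Fintype.card σ - j) =
      (-1) ^ j * MvPolynomial.aeval f (MvPolynomial.esymm σ ℂ j) := by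
    intro j hj
    have := Multiset.prod_X_sub_C_coeff (univ.val.map f) (k := Fintype.card σ - j) (by simp)
    rw [MvPolynomial.aeval_esymm_eq_multiset_esymm]
    simpa [Nat.sub_sub_self hj, Function.comp_def] using this
  have h := congrArg (MvPolynomial.aeval f) (MvPolynomial.mul_esymm_eq_sum σ ℂ k)
  simp only [map_mul, map_sum, map_natCast, map_pow, map_neg, map_one, MvPolynomial.psum,
    MvPolynomial.aeval_X] at h
  rw [hcoeff k hk, mul_left_comm, h, ← mul_assoc, ← pow_add, ← add_assoc, pow_succ, ← two_mul,
    pow_mul]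
  simp only [neg_one_sq, one_pow, one_mul, neg_mul]
  congr 1
  rw [sum_filter, Finset.Nat.sum_antidiagonal_eq_sum_range_succ_mk, sum_range_succ]
  simp only [lt_self_iff_false, if_false, add_zero]
  refine sum_congr rfl fun j hj => ?_
  have hj := mem_range.1 hj
  rw [if_pos hj, hcoeff j (by omega)]

theorem newton_identity_prod_pow {ι : Type*} [Fintype ι] (r : ι → ℂ) (m : ι → ℕ) (k : ℕ)
    (hk : k ≤ ∑ i, m i) :
    (k : ℂ) * (∏ i, (X - C (r i)) ^ m i).coeff ((∑ i, m i) - k) =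
      -∑ j ∈ range k, (∏ i, (X - C (r i)) ^ m i).coeff ((∑ i, m i) - j) *
        ∑ i, (m i : ℂ) * r i ^ (k - j) := by
  have h := newton_identity_prod (fun x : Σ i, Fin (m i) => r x.1) k (by simpa using hk)
  simpa [Fintype.prod_sigma, Fintype.sum_sigma] using h

theorem norm_power_sum_le {n : ℕ} {c : ℝ} (a s : ℕ → ℂ) (ha0 : a 0 = 1)
    (ha : ∀ j, 1 ≤ j → j ≤ n → ‖a j‖ ≤ c)
    (hs : ∀ k ≤ n, (k : ℂ) * a k = -∑ j ∈ range k, a j * s (k - j)) (k : ℕ) (hk : 1 ≤ k)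
    (hkn : k ≤ n) : ‖s k‖ ≤ (1 + c) ^ k - 1 := by
  have hc : 0 ≤ c := (norm_nonneg _).trans (ha 1 le_rfl (hk.trans hkn))
  have hgeom : ∀ i : ℕ, ((i : ℝ) + 1) * c + ∑ j ∈ range i, c * ((1 + c) ^ (i - j) - 1) =
      (1 + c) ^ (i + 1) - 1 := by
    intro i
    induction i with
    | zero => simp
    | succ i ih =>
      rw [sum_range_succ']
      simp only [Nat.add_sub_add_right, Nat.sub_zero, Nat.cast_add, Nat.cast_one]
      linear_combination ih
  induction k using Nat.strong_induction_on with
  | _ k ih =>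
    obtain ⟨i, rfl⟩ : ∃ i, k = i + 1 := ⟨k - 1, by omega⟩
    have h := hs _ hkn
    rw [sum_range_succ'] at h
    simp only [Nat.add_sub_add_right, Nat.sub_zero, ha0, one_mul] at h
    have h' : s (i + 1) =
        -(((i + 1 : ℕ) : ℂ) * a (i + 1) + ∑ j ∈ range i, a (j + 1) * s (i - j)) := by
      linear_combination h
    rw [h', norm_neg, ← hgeom]
    refine (norm_add_le _ _).trans (add_le_add ?_ ((norm_sum_le _ _).trans ?_))
    · rw [norm_mul, Complex.norm_natCast]
      push_cast
      exact mul_le_mul_of_nonneg_left (ha _ hk hkn) (by positivity)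
    · refine sum_le_sum fun j hj => ?_
      have hj := mem_range.1 hj
      rw [norm_mul]
      exact mul_le_mul (ha _ (by omega) (by omega))
        (ih (i - j) (by omega) (by omega) (by omega)) (norm_nonneg _) hc

section Moments

variable {ι κ : Type*} [Fintype ι]

theorem sum_mul_prod_insert [DecidableEq κ] (w z : ι → ℂ) (a : κ → ℂ) {k : κ} {s : Finset κ}
    (hk : k ∉ s) (l : ℕ) :
    ∑ j, w j * z j ^ (l + 1) * ∏ x ∈ insert k s, (z j - a x) =
      (∑ j, w j * z j ^ (l + 1 + 1) * ∏ x ∈ s, (z j - a x)) -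
        a k * ∑ j, w j * z j ^ (l + 1) * ∏ x ∈ s, (z j - a x) := by
  rw [mul_sum, ← sum_sub_distrib]
  refine sum_congr rfl fun j _ => ?_
  rw [prod_insert hk]
  ring

theorem sum_mul_prod_congr {N : ℕ} (w z w' z' : ι → ℂ) (a : κ → ℂ)
    (h : ∀ k, 1 ≤ k → k ≤ N → ∑ j, w j * z j ^ k = ∑ j, w' j * z' j ^ k) (s : Finset κ) (l : ℕ)
    (hl : l + 1 + #s ≤ N) :
    ∑ j, w j * z j ^ (l + 1) * ∏ x ∈ s, (z j - a x) =
      ∑ j, w' j * z' j ^ (l + 1) * ∏ x ∈ s, (z' j - a x) := by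
  classical
  induction s using Finset.induction_on generalizing l with
  | empty => simpa using h (l + 1) (by omega) (by simpa using hl)
  | insert k s hk ih =>
    rw [card_insert_of_notMem hk] at hl
    rw [sum_mul_prod_insert _ _ _ hk, sum_mul_prod_insert _ _ _ hk, ih l (by omega),
      ih (l + 1) (by omega)]

theorem norm_sum_mul_prod_le {N : ℕ} {K ρ : ℝ} (w z : ι → ℂ) (a : κ → ℂ)
    (ha : ∀ x, ‖a x‖ ≤ ρ) (h : ∀ k, 1 ≤ k → k ≤ N → ‖∑ j, w j * z j ^ k‖ ≤ K ^ k)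
    (s : Finset κ) (l : ℕ) (hl : l + 1 + #s ≤ N) :
    ‖∑ j, w j * z j ^ (l + 1) * ∏ x ∈ s, (z j - a x)‖ ≤ K ^ (l + 1) * (K + ρ) ^ #s := by
  classical
  induction s using Finset.induction_on generalizing l with
  | empty => simpa using h (l + 1) (by omega) (by simpa using hl)
  | insert k s hk ih =>
    rw [card_insert_of_notMem hk] at hl ⊢
    rw [sum_mul_prod_insert _ _ _ hk]
    have hρ : 0 ≤ ρ := (norm_nonneg _).trans (ha k)
    calc _ ≤ K ^ (l + 1 + 1) * (K + ρ) ^ #s + ρ * (K ^ (l + 1) * (K + ρ) ^ #s) := by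
          refine (norm_sub_le _ _).trans (add_le_add (ih (l + 1) (by omega)) ?_)
          rw [norm_mul]
          exact mul_le_mul (ha k) (ih l (by omega)) (norm_nonneg _) hρ
      _ = _ := by ring

theorem norm_sum_mul_prod_sub_le {N : ℕ} {K ρ ε : ℝ} (hK : 1 ≤ K) (w z : ι → ℂ) (a b : κ → ℂ)
    (ha : ∀ x, ‖a x‖ ≤ ρ) (hb : ∀ x, ‖b x‖ ≤ ρ) (hab : ∀ x, ‖a x - b x‖ ≤ ε)
    (h : ∀ k, 1 ≤ k → k ≤ N → ‖∑ j, w j * z j ^ k‖ ≤ K ^ k)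
    (s : Finset κ) (l : ℕ) (hl : l + 1 + #s ≤ N) :
    ‖(∑ j, w j * z j ^ (l + 1) * ∏ x ∈ s, (z j - a x)) -
      ∑ j, w j * z j ^ (l + 1) * ∏ x ∈ s, (z j - b x)‖ ≤
      #s * ε * (K ^ (l + 1) * (K + ρ) ^ #s) := by
  classical
  induction s using Finset.induction_on generalizing l with
  | empty => simp
  | insert k s hk ih =>
    rw [card_insert_of_notMem hk] at hl ⊢
    rw [sum_mul_prod_insert _ _ _ hk, sum_mul_prod_insert _ _ _ hk]
    have hρ : 0 ≤ ρ := (norm_nonneg _).trans (ha k)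
    have hε : 0 ≤ ε := (norm_nonneg _).trans (hab k)
    have h1 := ih (l + 1) (by omega)
    have h0 := ih l (by omega)
    have hB := norm_sum_mul_prod_le w z b hb h s l (by omega)
    set A1 := ∑ j, w j * z j ^ (l + 1 + 1) * ∏ x ∈ s, (z j - a x)
    set A0 := ∑ j, w j * z j ^ (l + 1) * ∏ x ∈ s, (z j - a x)
    set B1 := ∑ j, w j * z j ^ (l + 1 + 1) * ∏ x ∈ s, (z j - b x)
    set B0 := ∑ j, w j * z j ^ (l + 1) * ∏ x ∈ s, (z j - b x)
    have hsplit : A1 - a k * A0 - (B1 - b k * B0) =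
        (A1 - B1) - a k * (A0 - B0) - (a k - b k) * B0 := by ring
    rw [hsplit]
    calc _ ≤ #s * ε * (K ^ (l + 1 + 1) * (K + ρ) ^ #s) +
            ρ * (#s * ε * (K ^ (l + 1) * (K + ρ) ^ #s)) +
            ε * (K ^ (l + 1) * (K + ρ) ^ #s) := by
          refine (norm_sub_le _ _).trans (add_le_add ((norm_sub_le _ _).trans
            (add_le_add h1 ?_)) ?_)
          · rw [norm_mul]
            exact mul_le_mul (ha k) h0 (norm_nonneg _) hρ
          · rw [norm_mul]
            exact mul_le_mul (hab k) hB (norm_nonneg _) hε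
      _ ≤ #s * ε * (K ^ (l + 1 + 1) * (K + ρ) ^ #s) +
            ρ * (#s * ε * (K ^ (l + 1) * (K + ρ) ^ #s)) +
            ε * (K ^ (l + 1) * (K + ρ) ^ #s) * (K + ρ) := by
          refine add_le_add le_rfl ?_
          exact le_mul_of_one_le_right (by positivity) (by linarith)
      _ = _ := by push_cast; ring

end Moments

theorem sum_mul_prod_erase {ι : Type*} [Fintype ι] [DecidableEq ι] (w z : ι → ℂ) (i : ι) :
    ∑ j, w j * z j ^ (0 + 1) * ∏ x ∈ univ.erase i, (z j - z x) =
      w i * (z i * ∏ x ∈ univ.erase i, (z i - z x)) := by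
  rw [sum_eq_single i]
  · ring
  · intro j _ hj
    rw [prod_eq_zero (mem_erase.2 ⟨hj, mem_univ j⟩) (sub_self _), mul_zero]
  · simp

/-- The relative error of a Vandermonde-type product under perturbation of its nodes. -/
theorem norm_node_prod_div_sub_one_le {ι : Type*} [Fintype ι] [DecidableEq ι] (r rt : ι → ℂ)
    (i : ι) {δ : ℝ} (h0 : ‖r i / rt i - 1‖ ≤ δ)
    (h : ∀ k ≠ i, ‖(r i - r k) / (rt i - rt k) - 1‖ ≤ δ) (hδ : Fintype.card ι * δ ≤ 1) :
    ‖(r i * ∏ k ∈ univ.erase i, (r i - r k)) / (rt i * ∏ k ∈ univ.erase i, (rt i - rt k)) - 1‖ ≤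
      2 * (Fintype.card ι * δ) := by
  set f : ι → ℂ := fun k => if k = i then r i / rt i - 1 else (r i - r k) / (rt i - rt k) - 1
    with hf
  have hfδ : ∀ k, ‖f k‖ ≤ δ := by
    intro k
    by_cases hk : k = i
    · simpa [hf, hk] using h0
    · simpa [hf, hk] using h k hk
  have hprod : (r i * ∏ k ∈ univ.erase i, (r i - r k)) /
      (rt i * ∏ k ∈ univ.erase i, (rt i - rt k)) = ∏ k, (1 + f k) := by
    rw [← mul_prod_erase univ _ (mem_univ i), mul_div_mul_comm, ← prod_div_distrib]
    congr 1
    · simp [hf]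
    · refine prod_congr rfl fun k hk => ?_
      simp [hf, (mem_erase.1 hk).1]
  have hδ0 : 0 ≤ δ := (norm_nonneg _).trans h0
  have hnδ : 0 ≤ Fintype.card ι * δ := by positivity
  have hsum : ∑ k, ‖f k‖ ≤ Fintype.card ι * δ := by
    simpa using sum_le_sum fun k (_ : k ∈ univ) => hfδ k
  rw [hprod]
  refine (norm_prod_one_add_sub_one_le _ _).trans ?_
  have := Real.abs_exp_sub_one_le (x := Fintype.card ι * δ) (by rwa [abs_of_nonneg hnδ])
  rw [abs_of_nonneg hnδ] at this
  have hexp := Real.exp_le_exp.2 hsum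
  linarith [le_abs_self (Real.exp (Fintype.card ι * δ) - 1)]

theorem isUnit_nodes_matrix {n : ℕ} {z : Fin n → ℂ} (hz : Function.Injective z)
    (hz0 : ∀ i, z i ≠ 0) (V : Matrix (Fin n) (Fin n) ℂ)
    (hV : ∀ i j, V i j = z j ^ ((i : ℕ) + 1)) : IsUnit V := by
  have hVe : V = (Matrix.vandermonde z)ᵀ * Matrix.diagonal z := by
    ext i j
    simp [hV, Matrix.vandermonde_apply, pow_succ]
  rw [Matrix.isUnit_iff_isUnit_det, hVe, Matrix.det_mul, Matrix.det_transpose,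
    Matrix.det_diagonal, isUnit_iff_ne_zero]
  exact mul_ne_zero (Matrix.det_vandermonde_ne_zero_iff.2 hz) (prod_ne_zero_iff.2 fun i _ => hz0 i)

theorem isUnit_unitriangular {n : ℕ} (T : Matrix (Fin n) (Fin n) ℂ) (a : ℕ → ℂ) (ha : a 0 = 1)
    (hT : ∀ i j : Fin n, T i j = if (j : ℕ) ≤ (i : ℕ) then a ((i : ℕ) - (j : ℕ)) else 0) :
    IsUnit T := by
  have hlow : T.BlockTriangular OrderDual.toDual := by
    intro i j hij
    rw [hT, if_neg]
    exact not_le.2 hij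
  rw [Matrix.isUnit_iff_isUnit_det, Matrix.det_of_isLowerTriangular T hlow]
  simp [hT, ha]

theorem one_le_prod_norm_pow {ι : Type*} [Fintype ι] {p : ℤ[X]} {r : ι → ℂ} {m : ι → ℕ}
    (hr0 : ∀ i, r i ≠ 0) (hp : p.map (Int.castRingHom ℂ) = ∏ i, (X - C (r i)) ^ m i) :
    1 ≤ ∏ i, ‖r i‖ ^ m i := by
  have h := congrArg (fun q => ‖q.eval 0‖) hp
  simp only [eval_prod, eval_pow, eval_sub, eval_X, eval_C, zero_sub, norm_prod, norm_pow,
    norm_neg, eval_map, eval₂_at_zero, eq_intCast, Complex.norm_intCast] at h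
  have hpos : 0 < ∏ i, ‖r i‖ ^ m i := prod_pos fun i _ => pow_pos (norm_pos_iff.2 (hr0 i)) _
  rw [← h] at hpos ⊢
  have : p.coeff 0 ≠ 0 := by
    intro h0
    simp [h0] at hpos
  exact_mod_cast Int.one_le_abs this

/-- A bound for the multiplicities that does not deteriorate when one root is close to zero:
by integrality, that root is compensated by the remaining ones. -/
theorem multiplicity_le {n : ℕ} {r : Fin n → ℂ} {m : Fin n → ℕ}
    (hprod : 1 ≤ ∏ i, ‖r i‖ ^ m i) {μ R A : ℝ} (hμ0 : 0 < μ) (hμ1 : μ ≤ 1)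
    (hsep : ∀ i j, i ≠ j → μ ≤ ‖r i - r j‖) (hR1 : 1 ≤ R) (hR : ∀ i, ‖r i‖ ≤ R)
    (hA : ∀ j, m j * ‖r j‖ ≤ A) (i : Fin n) : m i * μ ≤ 4 * n * R * A := by
  have hA0 : 0 ≤ A := le_trans (by positivity) (hA i)
  have hn1 : (1 : ℝ) ≤ n := by exact_mod_cast Fin.pos i
  have hlarge : ∀ j, μ / 2 ≤ ‖r j‖ → m j * μ ≤ 2 * A := by
    intro j hj
    have := mul_le_mul_of_nonneg_left hj (Nat.cast_nonneg (α := ℝ) (m j))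
    linarith [hA j]
  by_cases hi : μ / 2 ≤ ‖r i‖
  · have hnR : 1 ≤ n * R := one_le_mul_of_one_le_of_one_le hn1 hR1
    nlinarith [hlarge i hi, mul_le_mul_of_nonneg_right hnR hA0]
  push Not at hi
  have hothers : ∀ j ∈ univ.erase i, μ / 2 ≤ ‖r j‖ := by
    intro j hj
    have h1 := hsep j i (mem_erase.1 hj).1
    linarith [norm_sub_le (r j) (r i)]
  set T : ℕ := ∑ j ∈ univ.erase i, m j with hT
  have hTμ : T * μ ≤ n * (2 * A) := by
    rw [hT, Nat.cast_sum, sum_mul]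
    calc _ ≤ ∑ j ∈ univ.erase i, 2 * A := sum_le_sum fun j hj => hlarge j (hothers j hj)
      _ ≤ ∑ j : Fin n, 2 * A := sum_le_sum_of_subset_of_nonneg (erase_subset _ _)
          fun _ _ _ => by positivity
      _ = _ := by simp
  have hpow : (2 : ℝ) ^ m i ≤ R ^ T := by
    have h1 : ∏ j, ‖r j‖ ^ m j ≤ (1 / 2) ^ m i * R ^ T := by
      rw [← mul_prod_erase univ _ (mem_univ i), hT, ← prod_pow_eq_pow_sum]
      gcongr
      · linarith
      · exact hR _
    have h2 := mul_le_mul_of_nonneg_left (hprod.trans h1) (by positivity : (0 : ℝ) ≤ 2 ^ m i)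
    rwa [← mul_assoc, ← mul_pow, mul_one, mul_one_div_cancel two_ne_zero, one_pow,
      one_mul] at h2
  have hlog := Real.log_le_log (by positivity) hpow
  rw [Real.log_pow, Real.log_pow] at hlog
  have hlogR := Real.log_le_sub_one_of_pos (zero_lt_one.trans_le hR1)
  have h1 : (m i : ℝ) * (1 / 2) ≤ T * R := by
    calc (m i : ℝ) * (1 / 2) ≤ m i * Real.log 2 := by
          gcongr
          linarith [Real.log_two_gt_d9]
      _ ≤ T * Real.log R := hlog
      _ ≤ T * R := by gcongr; linarith
  nlinarith [mul_le_mul_of_nonneg_right h1 hμ0.le,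
    mul_le_mul_of_nonneg_right hTμ (zero_le_one.trans hR1)]

theorem norm_div_sub_one_le {a b : ℂ} {η ν : ℝ} (hν : 0 < ν) (hb : ν ≤ ‖b‖) (hab : ‖b - a‖ ≤ η) :
    ‖a / b - 1‖ ≤ η / ν := by
  have hb0 : b ≠ 0 := norm_pos_iff.1 (hν.trans_le hb)
  rw [div_sub_one hb0, norm_div, norm_sub_rev]
  exact div_le_div₀ ((norm_nonneg _).trans hab) hab hν hb

/-- Perturbing separated nonzero nodes keeps them separated and nonzero, and changes the nodal
products only by a small relative amount. -/
theorem node_prod_perturbation {n : ℕ} {r rt : Fin n → ℂ} {ε μ ν : ℝ}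
    (hμ0 : 0 < μ) (hμ1 : μ ≤ 1) (hsep : ∀ i j, i ≠ j → μ ≤ ‖r i - r j‖)
    (hν0 : 0 < ν) (hν1 : ν ≤ 1) (hν : ∀ i, ν ≤ ‖r i‖) (hrt : ∀ i, ‖rt i - r i‖ ≤ ε)
    (hsmall : 128 * n * ε ≤ μ * ν) (i : Fin n) :
    (ν / 2 ≤ ‖rt i‖ ∧ ∀ x ≠ i, μ / 2 ≤ ‖rt i - rt x‖) ∧
      ‖(r i * ∏ x ∈ univ.erase i, (r i - r x)) /
        (rt i * ∏ x ∈ univ.erase i, (rt i - rt x)) - 1‖ ≤ 2 * (n * (4 * ε / (μ * ν))) := by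
  have hε0 : 0 ≤ ε := (norm_nonneg _).trans (hrt i)
  have hn1 : (1 : ℝ) ≤ n := by exact_mod_cast Fin.pos i
  have hεμ : 4 * ε ≤ μ := by nlinarith [mul_le_mul_of_nonneg_left hν1 hμ0.le]
  have hεν : 2 * ε ≤ ν := by nlinarith [mul_le_mul_of_nonneg_right hμ1 hν0.le]
  have hrtν : ν / 2 ≤ ‖rt i‖ := by
    have := norm_sub_norm_le (r i) (rt i)
    rw [norm_sub_rev] at this
    linarith [hν i, hrt i]
  have hdiff : ∀ x, ‖(rt i - rt x) - (r i - r x)‖ ≤ 2 * ε := by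
    intro x
    rw [show (rt i - rt x) - (r i - r x) = (rt i - r i) - (rt x - r x) by ring]
    linarith [norm_sub_le (rt i - r i) (rt x - r x), hrt i, hrt x]
  have hrtμ : ∀ x ≠ i, μ / 2 ≤ ‖rt i - rt x‖ := by
    intro x hx
    have := norm_sub_norm_le (r i - r x) (rt i - rt x)
    rw [norm_sub_rev (r i - r x)] at this
    linarith [hsep i x hx.symm, hdiff x]
  refine ⟨⟨hrtν, hrtμ⟩, ?_⟩
  set δ := 4 * ε / (μ * ν) with hδ
  have hnδ : n * δ ≤ 1 / 2 := by
    rw [hδ, ← mul_div_assoc, div_le_iff₀ (by positivity)]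
    nlinarith
  have := norm_node_prod_div_sub_one_le r rt i (δ := δ) ?_ ?_
    (by simpa using hnδ.trans (by norm_num))
  · simpa using this
  · refine (norm_div_sub_one_le (by linarith) hrtν (hrt i)).trans ?_
    rw [hδ, div_le_div_iff₀ (by positivity) (by positivity)]
    nlinarith [mul_nonneg hε0 hν0.le, mul_nonneg (mul_nonneg hε0 hν0.le) hμ0.le]
  · intro x hx
    refine (norm_div_sub_one_le (by linarith) (hrtμ x hx) (hdiff x)).trans ?_
    rw [hδ, div_le_div_iff₀ (by positivity) (by positivity)]
    nlinarith [mul_nonneg hε0 hμ0.le, mul_nonneg (mul_nonneg hε0 hμ0.le) (sub_nonneg.2 hν1)]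

/-- If weights `y` at perturbed nodes `rt` have the same first `n` moments as weights `m` at
nodes `r`, then `y` is close to `m`. -/
theorem norm_weight_sub_lt_half {n : ℕ} {r rt : Fin n → ℂ} {m : Fin n → ℕ} {y : Fin n → ℂ}
    {ε μ ν R c : ℝ} (hprod : 1 ≤ ∏ i, ‖r i‖ ^ m i)
    (hμ0 : 0 < μ) (hμ1 : μ ≤ 1) (hsep : ∀ i j, i ≠ j → μ ≤ ‖r i - r j‖)
    (hν0 : 0 < ν) (hν1 : ν ≤ 1) (hν : ∀ i, ν ≤ ‖r i‖)
    (hR1 : 1 ≤ R) (hR : ∀ i, ‖r i‖ ≤ R) (hc1 : 1 ≤ c)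
    (hrt : ∀ i, ‖rt i - r i‖ ≤ ε)
    (hε : 128 * n ^ 5 * (4 * R * c) ^ n * ε ≤ μ ^ (n + 2) * ν)
    (hs : ∀ k, 1 ≤ k → k ≤ n → ‖∑ i, (m i : ℂ) * r i ^ k‖ ≤ (1 + c) ^ k)
    (hy : ∀ k, 1 ≤ k → k ≤ n → ∑ i, y i * rt i ^ k = ∑ i, (m i : ℂ) * r i ^ k)
    (i : Fin n) : ‖y i - m i‖ < 1 / 2 := by
  have hε0 : 0 ≤ ε := (norm_nonneg _).trans (hrt i)
  have hn1 : (1 : ℝ) ≤ n := by exact_mod_cast Fin.pos i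
  have hRc : 1 ≤ R * c := one_le_mul_of_one_le_of_one_le hR1 hc1
  obtain ⟨k, hk⟩ : ∃ k, n = k + 1 := ⟨n - 1, by have := Fin.pos i; omega⟩
  have hcard : #(univ.erase i) = k := by simp [hk]
  set D := (4 * R * c) ^ n with hD
  have hD1 : 1 ≤ D := one_le_pow₀ (by linarith)
  have hn5 : (n : ℝ) ^ 2 ≤ n ^ 5 := pow_le_pow_right₀ hn1 (by norm_num)
  have hnn : (n : ℝ) ≤ n ^ 2 := by nlinarith
  have hμn1 : μ ^ n ≤ 1 := pow_le_one₀ hμ0.le hμ1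
  have hkey : 128 * n ^ 2 * D * ε ≤ μ ^ n * (μ ^ 2 * ν) :=
    calc _ ≤ 128 * n ^ 5 * D * ε := by gcongr
      _ ≤ _ := hε
      _ = _ := by ring
  have hμν : μ ^ 2 * ν ≤ μ * ν := by nlinarith [mul_pos hμ0 hν0]
  have hsmall : 128 * n * ε ≤ μ * ν :=
    calc 128 * n * ε ≤ 128 * n ^ 2 * D * ε := by
          rw [mul_assoc (128 : ℝ) (n ^ 2 : ℝ)]
          gcongr
          exact hnn.trans (le_mul_of_one_le_right (by positivity) hD1)
      _ ≤ _ := hkey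
      _ ≤ 1 * (μ * ν) := by gcongr
      _ = _ := one_mul _
  -- the nodal products and their quotient
  set P := r i * ∏ x ∈ univ.erase i, (r i - r x) with hP
  set Q := rt i * ∏ x ∈ univ.erase i, (rt i - rt x) with hQ
  have hPge : ν * μ ^ k ≤ ‖P‖ := by
    rw [hP, norm_mul, norm_prod, ← hcard, ← prod_const]
    gcongr with x hx
    · exact hν i
    · exact hsep _ _ (mem_erase.1 hx).1.symm
  have hP0 : P ≠ 0 := norm_pos_iff.1 (lt_of_lt_of_le (by positivity) hPge)
  obtain ⟨⟨hrtν, hrtμ⟩, hratio⟩ :=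
    node_prod_perturbation hμ0 hμ1 hsep hν0 hν1 hν hrt hsmall i
  have hQ0 : Q ≠ 0 := by
    refine mul_ne_zero (norm_pos_iff.1 (by linarith)) (prod_ne_zero_iff.2 fun x hx => ?_)
    exact norm_pos_iff.1 (lt_of_lt_of_le (by linarith) (hrtμ x (mem_erase.1 hx).1))
  set δ := 4 * ε / (μ * ν) with hδ
  have hnδ : n * δ ≤ 1 / 2 := by
    rw [hδ, ← mul_div_assoc, div_le_iff₀ (by positivity)]
    linarith [mul_pos hμ0 hν0]
  have hratio2 : ‖P / Q‖ ≤ 2 := by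
    have := norm_le_norm_add_norm_sub' (P / Q) 1
    rw [norm_one] at this
    linarith
  -- the weights as values of moment functionals
  have hyQ : y i * Q = ∑ j, (m j : ℂ) * r j ^ (0 + 1) * ∏ x ∈ univ.erase i, (r j - rt x) := by
    rw [hQ, ← sum_mul_prod_erase]
    exact sum_mul_prod_congr _ _ _ _ _ hy _ _ (by omega)
  have hB : 2 * c * (4 * R * c) ^ k * (2 * R) = D := by
    rw [hD, hk]
    ring
  have hsum4 : 1 + c + (R + 1) ≤ 4 * R * c := by nlinarith
  have hmB : ∀ j, m j * ‖r j‖ ≤ 2 * c * (4 * R * c) ^ k / μ ^ k := by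
    intro j
    have hj : #(univ.erase j) = k := by simp [hk]
    have h := norm_sum_mul_prod_le (fun i => (m i : ℂ)) r r (ρ := R + 1)
      (fun x => (hR x).trans (by linarith)) hs (univ.erase j) 0 (by omega)
    rw [sum_mul_prod_erase, hj, norm_mul, norm_mul, Complex.norm_natCast, norm_prod] at h
    rw [le_div_iff₀ (by positivity)]
    calc m j * ‖r j‖ * μ ^ k ≤ m j * (‖r j‖ * ∏ x ∈ univ.erase j, ‖r j - r x‖) := by
          rw [mul_assoc, ← hj, ← prod_const]
          gcongr with x hx
          exact hsep _ _ (mem_erase.1 hx).1.symm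
      _ ≤ _ := h
      _ ≤ _ := by
          rw [zero_add, pow_one]
          gcongr
          linarith
  have hmi : m i * μ ^ n ≤ 2 * n * D := by
    have h := multiplicity_le hprod hμ0 hμ1 hsep hR1 hR hmB i
    rw [← mul_div_assoc, le_div_iff₀ (by positivity)] at h
    rw [← hB, show μ ^ n = μ * μ ^ k by rw [hk, pow_succ']]
    linarith
  have hPm := sum_mul_prod_erase (fun j => (m j : ℂ)) r i
  have hε1 : ε ≤ 1 := by nlinarith [mul_le_one₀ hμ1 hν0.le hν1]
  have hdS := norm_sum_mul_prod_sub_le (by linarith) (fun i => (m i : ℂ)) r rt r (ρ := R + 1)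
    (ε := ε) (fun x => by linarith [norm_le_norm_add_norm_sub' (rt x) (r x), hR x, hrt x])
    (fun x => (hR x).trans (by linarith)) hrt hs (univ.erase i) 0 (by omega)
  rw [← hyQ, hPm, hcard, zero_add, pow_one] at hdS
  have hdS2 : ‖y i * Q - m i * P‖ ≤ n * ε * (D / 2) :=
    calc _ ≤ _ := hdS
      _ ≤ n * ε * (2 * c * (4 * R * c) ^ k) := by
          gcongr
          · exact_mod_cast (by omega : k ≤ n)
          · linarith
      _ ≤ n * ε * (D / 2) := by
          gcongr
          rw [← hB]
          have : 0 ≤ 2 * c * (4 * R * c) ^ k := by positivity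
          nlinarith
  have hsplit : y i - m i = P / Q * ((y i * Q - m i * P) / P) + m i * (P / Q - 1) := by
    field_simp
    ring
  have hfirst : ‖P / Q * ((y i * Q - m i * P) / P)‖ ≤ 2 * (1 / 16) := by
    rw [norm_mul, norm_div (y i * Q - m i * P)]
    refine mul_le_mul hratio2 ?_ (by positivity) (by norm_num)
    rw [div_le_iff₀ (norm_pos_iff.2 hP0)]
    have h1 : μ ^ n * (μ ^ 2 * ν) ≤ ν * μ ^ k :=
      calc μ ^ n * (μ ^ 2 * ν) = ν * μ ^ k * μ ^ 3 := by rw [hk]; ring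
        _ ≤ ν * μ ^ k * 1 := by gcongr; exact pow_le_one₀ hμ0.le hμ1
        _ = _ := mul_one _
    have h2 : n * D * ε ≤ n ^ 2 * D * ε := by gcongr
    have h3 : 0 ≤ n ^ 2 * D * ε := by positivity
    linarith
  have hsecond : ‖m i * (P / Q - 1)‖ ≤ 1 / 4 := by
    rw [norm_mul, Complex.norm_natCast]
    have h1 : m i * (32 * n * ε) ≤ μ * ν := by
      refine le_of_mul_le_mul_left ?_ (by positivity : 0 < μ ^ n)
      calc μ ^ n * (m i * (32 * n * ε)) = (m i * μ ^ n) * (32 * n * ε) := by ring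
        _ ≤ (2 * n * D) * (32 * n * ε) := by gcongr
        _ ≤ 128 * n ^ 2 * D * ε := by
            have h3 : 0 ≤ n ^ 2 * D * ε := by positivity
            linarith
        _ ≤ _ := hkey
        _ ≤ _ := by gcongr
    calc m i * ‖P / Q - 1‖ ≤ m i * (2 * (n * δ)) := by gcongr
      _ = m i * (32 * n * ε) / (μ * ν) / 4 := by rw [hδ]; ring
      _ ≤ 1 / 4 := by
          gcongr
          exact div_le_one_of_le₀ h1 (by positivity)
  rw [hsplit]
  linarith [norm_add_le (P / Q * ((y i * Q - m i * P) / P)) (m i * (P / Q - 1))]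

/-- Theorem 2: numerical stability of the multiplicity computation. If the distinct
nonzero complex roots `r_i` of a monic integer polynomial `p` are approximated by
`r̃_i` to within
`ε < (m² r / (2^{2n+7} n⁵)) (m/(MRc))^n`, then the approximate roots are pairwise
distinct and nonzero, the matrix `Λ C Ṽ₀` is invertible, and each entry of
`(Λ C Ṽ₀)⁻¹ c` lies within `1/2` of the corresponding multiplicity, which is thus
the unique integer within distance `1/2` of it. -/
theorem multiplicity_computation_stable
    (p : Polynomial ℤ) (hmonic : p.Monic) (t : ℕ) (ht : p.natDegree = t)
    (n : ℕ) (r : Fin n → ℂ) (hr : Function.Injective r) (hr0 : ∀ i, r i ≠ 0)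
    (m : Fin n → ℕ) (hm : ∀ i, 1 ≤ m i)
    (hp : p.map (Int.castRingHom ℂ) = ∏ i, (X - C (r i)) ^ m i)
    (M mm R rr c : ℝ)
    (hM : M = max (sSup {d : ℝ | ∃ i j : Fin n, d = ‖r i - r j‖}) 1)
    (hmm : mm = min (sInf {d : ℝ | ∃ i j : Fin n, i ≠ j ∧ d = ‖r i - r j‖}) 1)
    (hR : R = max (sSup {d : ℝ | ∃ i : Fin n, d = ‖r i‖}) 1)
    (hrr : rr = min (sInf {d : ℝ | ∃ i : Fin n, d = ‖r i‖}) 1)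
    (hc : c = max (sSup {x : ℝ | ∃ i : ℕ, 1 ≤ i ∧ i ≤ n ∧ x = |((p.coeff (t - i) : ℤ) : ℝ)|}) 1)
    (rt : Fin n → ℂ) (ε : ℝ) (hε0 : 0 < ε)
    (hε : ε < mm ^ 2 * rr / (2 ^ (2 * n + 7) * (n : ℝ) ^ 5) * (mm / (M * R * c)) ^ n)
    (hrt : ∀ i, ‖rt i - r i‖ ≤ ε)
    (Vt0 : Matrix (Fin n) (Fin n) ℂ)
    (hVt0 : ∀ i j : Fin n, Vt0 i j = rt j ^ ((i : ℕ) + 1))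
    (Cm : Matrix (Fin n) (Fin n) ℂ)
    (hCm : ∀ i j : Fin n, Cm i j =
      if (j : ℕ) ≤ (i : ℕ) then ((p.coeff (t - ((i : ℕ) - (j : ℕ))) : ℤ) : ℂ) else 0)
    (Λ : Matrix (Fin n) (Fin n) ℂ)
    (hΛ : Λ = Matrix.diagonal fun i : Fin n => -(1 / (((i : ℕ) + 1 : ℕ) : ℂ)))
    (mt : Fin n → ℂ)
    (hmt : mt = (Λ * Cm * Vt0)⁻¹ *ᵥ fun j : Fin n => ((p.coeff (t - ((j : ℕ) + 1)) : ℤ) : ℂ)) :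
    Function.Injective rt ∧ (∀ i, rt i ≠ 0) ∧ IsUnit (Λ * Cm * Vt0) ∧
      (∀ i : Fin n, ‖mt i - (m i : ℂ)‖ < 1 / 2) ∧
      ∀ (i : Fin n) (z : ℤ), ‖mt i - (z : ℂ)‖ < 1 / 2 → z = (m i : ℤ) := by
  have hcast : ∀ j, ((p.coeff j : ℤ) : ℂ) = (∏ i, (X - C (r i)) ^ m i).coeff j := by
    intro j
    rw [← hp, coeff_map, eq_intCast]
  have htm : t = ∑ i, m i := by
    rw [← ht, ← hmonic.natDegree_map (Int.castRingHom ℂ), hp,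
      natDegree_prod_of_monic _ _ fun i _ => (monic_X_sub_C _).pow _]
    simp [natDegree_pow]
  have hnt : n ≤ t := by
    rw [htm]
    simpa using sum_le_sum fun i (_ : i ∈ univ) => hm i
  have hn2 : 2 ≤ n := by
    by_contra hn
    have hlt := hε0.trans hε
    interval_cases n
    · simp at hlt
    · simp [hmm] at hlt
  have hfinM : {d : ℝ | ∃ i j : Fin n, i ≠ j ∧ d = ‖r i - r j‖}.Finite :=
    (Set.finite_range fun x : Fin n × Fin n => ‖r x.1 - r x.2‖).subset
      (by rintro _ ⟨i, j, _, rfl⟩; exact ⟨(i, j), rfl⟩)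
  have hfinR : {d : ℝ | ∃ i : Fin n, d = ‖r i‖}.Finite :=
    (Set.finite_range fun i => ‖r i‖).subset (by rintro _ ⟨i, rfl⟩; exact ⟨i, rfl⟩)
  have hfinc : {x : ℝ | ∃ i : ℕ, 1 ≤ i ∧ i ≤ n ∧ x = |((p.coeff (t - i) : ℤ) : ℝ)|}.Finite :=
    ((Set.finite_Icc 1 n).image fun i => |((p.coeff (t - i) : ℤ) : ℝ)|).subset
      (by rintro _ ⟨i, h1, h2, rfl⟩; exact ⟨i, ⟨h1, h2⟩, rfl⟩)
  have hM1 : 1 ≤ M := hM ▸ le_max_right _ _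
  have hR1 : 1 ≤ R := hR ▸ le_max_right _ _
  have hc1 : 1 ≤ c := hc ▸ le_max_right _ _
  have hmm1 : mm ≤ 1 := hmm ▸ min_le_right _ _
  have hrr1 : rr ≤ 1 := hrr ▸ min_le_right _ _
  have hsep : ∀ i j, i ≠ j → mm ≤ ‖r i - r j‖ := fun i j hij =>
    hmm ▸ (min_le_left _ _).trans (csInf_le hfinM.bddBelow ⟨i, j, hij, rfl⟩)
  have hRle : ∀ i, ‖r i‖ ≤ R := fun i =>
    hR ▸ (le_csSup hfinR.bddAbove ⟨i, rfl⟩).trans (le_max_left _ _)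
  have hrle : ∀ i, rr ≤ ‖r i‖ := fun i =>
    hrr ▸ (min_le_left _ _).trans (csInf_le hfinR.bddBelow ⟨i, rfl⟩)
  have hcle : ∀ j, 1 ≤ j → j ≤ n → ‖((p.coeff (t - j) : ℤ) : ℂ)‖ ≤ c := fun j h1 h2 => by
    rw [Complex.norm_intCast, hc]
    exact (le_csSup hfinc.bddAbove ⟨j, h1, h2, rfl⟩).trans (le_max_left _ _)
  have hmm0 : 0 < mm := by
    rw [hmm, lt_min_iff]
    refine ⟨?_, one_pos⟩
    have hne : {d : ℝ | ∃ i j : Fin n, i ≠ j ∧ d = ‖r i - r j‖}.Nonempty :=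
      ⟨_, ⟨0, by omega⟩, ⟨1, by omega⟩, by simp, rfl⟩
    obtain ⟨i, j, hij, h⟩ := hne.csInf_mem hfinM
    rw [h]
    exact norm_pos_iff.2 (sub_ne_zero.2 (hr.ne hij))
  have hrr0 : 0 < rr := by
    rw [hrr, lt_min_iff]
    refine ⟨?_, one_pos⟩
    have hne : {d : ℝ | ∃ i : Fin n, d = ‖r i‖}.Nonempty := ⟨_, ⟨0, by omega⟩, rfl⟩
    obtain ⟨i, h⟩ := hne.csInf_mem hfinR
    rw [h]
    exact norm_pos_iff.2 (hr0 i)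
  have hn1 : (1 : ℝ) ≤ n := by exact_mod_cast (by omega : 1 ≤ n)
  have hRc : 1 ≤ R * c := one_le_mul_of_one_le_of_one_le hR1 hc1
  have hεn : 128 * n ^ 5 * (4 * R * c) ^ n * ε ≤ mm ^ (n + 2) * rr := by
    have h1 : 128 * n ^ 5 * (4 * (M * R * c)) ^ n * ε ≤ mm ^ (n + 2) * rr := by
      have h4 : (2 : ℝ) ^ (2 * n + 7) = 4 ^ n * 128 := by
        rw [pow_add, pow_mul]
        norm_num
      rw [h4, div_pow, div_mul_div_comm, lt_div_iff₀ (by positivity)] at hε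
      rw [mul_pow]
      calc _ = ε * (4 ^ n * 128 * n ^ 5 * (M * R * c) ^ n) := by ring
        _ ≤ _ := hε.le
        _ = _ := by ring
    refine le_trans ?_ h1
    gcongr 128 * n ^ 5 * ?_ ^ n * ε
    nlinarith [mul_le_mul_of_nonneg_right hM1 (zero_le_one.trans hRc)]
  have hsmall : 128 * n * ε ≤ mm * rr := by
    have h5 : (n : ℝ) ≤ n ^ 5 := le_self_pow₀ hn1 (by norm_num)
    have hD : 1 ≤ (4 * R * c) ^ n := one_le_pow₀ (by linarith)
    calc 128 * n * ε = 128 * n * 1 * ε := by ring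
      _ ≤ 128 * n ^ 5 * (4 * R * c) ^ n * ε := by gcongr
      _ ≤ _ := hεn
      _ ≤ mm ^ 1 * rr := by
          gcongr ?_ * rr
          exact pow_le_pow_of_le_one hmm0.le hmm1 (by omega)
      _ = _ := by rw [pow_one]
  have hpert := fun i =>
    (node_prod_perturbation hmm0 hmm1 hsep hrr0 hrr1 hrle hrt hsmall i).1
  have hrt0 : ∀ i, rt i ≠ 0 := fun i => norm_pos_iff.1 (by linarith [(hpert i).1])
  have hrtinj : Function.Injective rt := by
    intro i j hij
    by_contra hne
    have := (hpert i).2 j (Ne.symm hne)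
    rw [hij, sub_self, norm_zero] at this
    linarith
  have hV := isUnit_nodes_matrix hrtinj hrt0 Vt0 hVt0
  have hCu : IsUnit Cm := isUnit_unitriangular Cm (fun j => ((p.coeff (t - j) : ℤ) : ℂ))
    (by simp [← ht, hmonic.coeff_natDegree]) hCm
  have hΛu : IsUnit Λ := by
    rw [hΛ, Matrix.isUnit_diagonal, Pi.isUnit_iff]
    intro i
    rw [isUnit_iff_ne_zero]
    exact neg_ne_zero.2 (one_div_ne_zero (Nat.cast_ne_zero.2 (Nat.succ_ne_zero _)))
  have hA := (hΛu.mul hCu).mul hV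
  set s : ℕ → ℂ := fun k => ∑ i, (m i : ℂ) * r i ^ k with hs
  have hnewton : ∀ k ≤ n, (k : ℂ) * ((p.coeff (t - k) : ℤ) : ℂ) =
      -∑ j ∈ range k, ((p.coeff (t - j) : ℤ) : ℂ) * s (k - j) := by
    intro k hk
    simp only [hcast, htm]
    exact newton_identity_prod_pow r m k (by omega)
  have hsbound : ∀ k, 1 ≤ k → k ≤ n → ‖s k‖ ≤ (1 + c) ^ k := fun k h1 h2 =>
    (norm_power_sum_le (fun j => ((p.coeff (t - j) : ℤ) : ℂ)) s
      (by simp [← ht, hmonic.coeff_natDegree]) hcle hnewton k h1 h2).trans (by linarith)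
  have hcs : (fun j : Fin n => ((p.coeff (t - ((j : ℕ) + 1)) : ℤ) : ℂ)) =
      (Λ * Cm) *ᵥ fun j => s ((j : ℕ) + 1) := by
    ext i
    have hsum : ∑ j : Fin n, Cm i j * s ((j : ℕ) + 1) =
        ∑ j ∈ range ((i : ℕ) + 1), ((p.coeff (t - j) : ℤ) : ℂ) * s ((i : ℕ) + 1 - j) := by
      rw [← sum_range_reflect]
      have hsub : range ((i : ℕ) + 1) = {j ∈ range n | j ≤ (i : ℕ)} := by
        ext j
        simp only [mem_range, mem_filter]
        omega
      rw [hsub, sum_filter, ← Fin.sum_univ_eq_sum_range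
        (fun j => if j ≤ (i : ℕ) then _ else (0 : ℂ))]
      refine sum_congr rfl fun j _ => ?_
      rw [hCm]
      split_ifs with h
      · rw [show (i : ℕ) + 1 - 1 - j = i - j by omega, show (i : ℕ) + 1 - (i - j) = j + 1 by omega]
      · rw [zero_mul]
    have hi : (((i : ℕ) + 1 : ℕ) : ℂ) ≠ 0 := Nat.cast_ne_zero.2 (Nat.succ_ne_zero _)
    rw [← Matrix.mulVec_mulVec, hΛ, Matrix.mulVec_diagonal]
    simp only [Matrix.mulVec, dotProduct]
    rw [hsum]
    have h := hnewton ((i : ℕ) + 1) (by omega)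
    field_simp
    linear_combination h
  have hVmt : Vt0 *ᵥ mt = fun j : Fin n => s ((j : ℕ) + 1) := by
    have h : (Λ * Cm) *ᵥ (Vt0 *ᵥ mt) = (Λ * Cm) *ᵥ fun j : Fin n => s ((j : ℕ) + 1) := by
      rw [Matrix.mulVec_mulVec, hmt, Matrix.mulVec_mulVec,
        Matrix.mul_nonsing_inv _ ((Matrix.isUnit_iff_isUnit_det _).1 hA), Matrix.one_mulVec, hcs]
    exact Matrix.mulVec_injective_of_isUnit (hΛu.mul hCu) h
  have hmoments : ∀ k, 1 ≤ k → k ≤ n → ∑ i, mt i * rt i ^ k = s k := by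
    intro k h1 h2
    have h := congrFun hVmt ⟨k - 1, by omega⟩
    simpa [Matrix.mulVec, dotProduct, hVt0, Nat.sub_add_cancel h1, mul_comm] using h
  have hclose : ∀ i, ‖mt i - (m i : ℂ)‖ < 1 / 2 := norm_weight_sub_lt_half
    (one_le_prod_norm_pow hr0 hp) hmm0 hmm1 hsep hrr0 hrr1 hrle hR1 hRle hc1 hrt hεn hsbound
    hmoments
  refine ⟨hrtinj, hrt0, hA, hclose, fun i z hz => ?_⟩
  have h : ‖(((z - m i : ℤ)) : ℂ)‖ < 1 := by
    have := norm_sub_le (mt i - (m i : ℂ)) (mt i - (z : ℂ))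
    rw [sub_sub_sub_cancel_left] at this
    push_cast
    linarith [hclose i]
  rw [Complex.norm_intCast] at h
  have h' : |z - m i| < 1 := by exact_mod_cast h
  exact sub_eq_zero.1 (Int.abs_lt_one_iff.1 h')
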